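/- arXiv:2411.16628 — 6 statements merged into one kernel-verified Lean document; each statement's English description precedes it below -/
import Mathlib

section
/- Under the standing setting and assumption (H4'), there exists a constant C' > 0 (one may take C' = C·Σ_n Θ_n) such that for every t ∈ [0,ε] and every φ ∈ C¹(M): |μ_t(φ) − μ₀(φ)| ≤ C' ‖φ‖_{C¹} t, where μ₀(φ) = ∫_M φ h₀ dm. -/
open MeasureTheory Filter Topology Set

noncomputable section

/-- The open unit square `M = (0,1)²`. -/
def unitOpenSq : Set (ℝ × ℝ) := Set.Ioo (0:ℝ) 1 ×ˢ Set.Ioo (0:ℝ) 1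

/-- The closed unit square `[0,1]²`. -/
def unitSq : Set (ℝ × ℝ) := Set.Icc (0:ℝ) 1 ×ˢ Set.Icc (0:ℝ) 1

/-- The `C¹` norm of `φ`: supremum over `[0,1]²` of `max |φ| ‖Dφ‖`. -/
def C1norm (φ : ℝ × ℝ → ℝ) : ℝ :=
  sSup ((fun x => max |φ x| ‖fderiv ℝ φ x‖) '' unitSq)

theorem C1norm_nonneg (φ : ℝ × ℝ → ℝ) : 0 ≤ C1norm φ := by
  refine Real.sSup_nonneg ?_
  rintro _ ⟨x, -, rfl⟩
  exact le_max_of_le_left (abs_nonneg _)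

theorem measurableSet_unitOpenSq : MeasurableSet unitOpenSq :=
  measurableSet_Ioo.prod measurableSet_Ioo

theorem exists_abs_le_on_unitOpenSq {φ : ℝ × ℝ → ℝ} (hφ : Continuous φ) :
    ∃ B : ℝ, ∀ x ∈ unitOpenSq, |φ x| ≤ B := by
  have hK : IsCompact unitSq := isCompact_Icc.prod isCompact_Icc
  obtain ⟨B, hB⟩ := hK.exists_bound_of_continuousOn hφ.continuousOn
  exact ⟨B, fun x hx => hB x (Set.prod_mono Ioo_subset_Icc_self Ioo_subset_Icc_self hx)⟩

theorem integrableOn_comp_iterate_mul {φ h : ℝ × ℝ → ℝ} {G : ℝ × ℝ → ℝ × ℝ}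
    (hφ : Continuous φ) (hG : Measurable G) (hmaps : MapsTo G unitOpenSq unitOpenSq)
    (hh : IntegrableOn h unitOpenSq) (n : ℕ) :
    IntegrableOn (fun x => φ (G^[n] x) * h x) unitOpenSq := by
  obtain ⟨B, hB⟩ := exists_abs_le_on_unitOpenSq hφ
  refine Integrable.bdd_mul (c := B) hh
    (hφ.measurable.comp (hG.iterate n)).aestronglyMeasurable ?_
  filter_upwards [ae_restrict_mem measurableSet_unitOpenSq] with x hx
  exact hB _ (hmaps.iterate n hx)

theorem integral_comp_iterate_eq_of_invariant {φ h : ℝ × ℝ → ℝ} {G : ℝ × ℝ → ℝ × ℝ}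
    (hφ : Continuous φ) (hG : Measurable G) (hmaps : MapsTo G unitOpenSq unitOpenSq)
    (hinv : ∀ ψ : ℝ × ℝ → ℝ, Measurable ψ → (∃ B : ℝ, ∀ x ∈ unitOpenSq, |ψ x| ≤ B) →
      ∫ x in unitOpenSq, ψ (G x) * h x = ∫ x in unitOpenSq, ψ x * h x) (n : ℕ) :
    ∫ x in unitOpenSq, φ (G^[n] x) * h x = ∫ x in unitOpenSq, φ x * h x := by
  induction n with
  | zero => rfl
  | succ n ih =>
    obtain ⟨B, hB⟩ := exists_abs_le_on_unitOpenSq hφ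
    rw [← ih]
    exact hinv (fun x => φ (G^[n] x)) (hφ.measurable.comp (hG.iterate n))
      ⟨B, fun x hx => hB _ (hmaps.iterate n hx)⟩

theorem abs_sub_zero_le_of_tendsto_of_abs_succ_sub_le {u a : ℕ → ℝ} {l : ℝ}
    (hu : Tendsto u atTop (𝓝 l)) (ha : Summable a)
    (h : ∀ n, |u (n + 1) - u n| ≤ a n) : |l - u 0| ≤ ∑' n, a n := by
  rw [abs_sub_comm, ← Real.dist_eq]
  refine dist_le_tsum_of_dist_le_of_tendsto₀ a (fun n => ?_) ha hu
  rw [Real.dist_eq, abs_sub_comm]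
  exact h n

/-- Lipschitz continuity of the physical measures under (H4'). -/
theorem lipschitz_continuity_of_physical_measure
    (ε : ℝ) (hε : 0 < ε)
    (F : ℝ → ℝ × ℝ → ℝ × ℝ)
    (hFmeas : ∀ t ∈ Set.Icc (0:ℝ) ε, Measurable (F t))
    (hFmaps : ∀ t ∈ Set.Icc (0:ℝ) ε, Set.MapsTo (F t) unitOpenSq unitOpenSq)
    (h₀ : ℝ × ℝ → ℝ)
    (h₀meas : Measurable h₀)
    (h₀C2 : ContDiffOn ℝ 2 h₀ unitSq)
    (h₀nonneg : ∀ x ∈ unitOpenSq, 0 ≤ h₀ x)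
    (h₀prob : ∫ x in unitOpenSq, h₀ x = 1)
    (h₀inv : ∀ φ : ℝ × ℝ → ℝ, Measurable φ → (∃ B : ℝ, ∀ x ∈ unitOpenSq, |φ x| ≤ B) →
      ∫ x in unitOpenSq, φ (F 0 x) * h₀ x = ∫ x in unitOpenSq, φ x * h₀ x)
    (μ : ℝ → (ℝ × ℝ → ℝ) → ℝ)
    (hμ : ∀ t ∈ Set.Icc (0:ℝ) ε, ∀ φ : ℝ × ℝ → ℝ, Continuous φ →
      Tendsto (fun n : ℕ => ∫ x in unitOpenSq, φ ((F t)^[n] x) * h₀ x) atTop (𝓝 (μ t φ)))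
    (C : ℝ) (hC : 0 < C)
    (Θ : ℕ → ℝ) (hΘ : ∀ n, 0 ≤ Θ n) (hΘsum : Summable Θ)
    (hH4' : ∀ t ∈ Set.Ioc (0:ℝ) ε, ∀ n : ℕ, ∀ φ : ℝ × ℝ → ℝ, ContDiff ℝ 1 φ →
      |∫ x in unitOpenSq, (φ ((F t)^[n+1] x) - φ ((F t)^[n] x)) * h₀ x|
        ≤ C * Θ n * C1norm φ * t) :
    ∃ C' > 0, ∀ t ∈ Set.Icc (0:ℝ) ε, ∀ φ : ℝ × ℝ → ℝ, ContDiff ℝ 1 φ →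
      |μ t φ - ∫ x in unitOpenSq, φ x * h₀ x| ≤ C' * C1norm φ * t := by
  have hh : IntegrableOn h₀ unitOpenSq := by
    refine not_imp_comm.1 integral_undef ?_
    rw [h₀prob]
    exact one_ne_zero
  have hS : 0 ≤ C * ∑' n, Θ n := mul_nonneg hC.le (tsum_nonneg hΘ)
  refine ⟨C * ∑' n, Θ n + 1, by positivity, fun t ht φ hφ => ?_⟩
  have hN := C1norm_nonneg φ
  have hlim := hμ t ht φ hφ.continuous
  rcases ht.1.eq_or_lt with rfl | htpos
  · simp only [integral_comp_iterate_eq_of_invariant hφ.continuous (hFmeas 0 ht) (hFmaps 0 ht)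
      h₀inv] at hlim
    simp [tendsto_nhds_unique hlim tendsto_const_nhds]
  · have hint := integrableOn_comp_iterate_mul hφ.continuous (hFmeas t ht) (hFmaps t ht) hh
    have key := abs_sub_zero_le_of_tendsto_of_abs_succ_sub_le
      (a := fun n => Θ n * (C * C1norm φ * t)) hlim (hΘsum.mul_right _) fun n => by
        rw [← integral_sub (hint (n + 1)) (hint n)]
        simp only [← sub_mul]
        exact (hH4' t ⟨htpos, ht.2⟩ n φ hφ).trans_eq (by ring)
    rw [tsum_mul_right] at key
    calc |μ t φ - ∫ x in unitOpenSq, φ x * h₀ x| ≤ (∑' n, Θ n) * (C * C1norm φ * t) := key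
      _ ≤ (C * ∑' n, Θ n + 1) * C1norm φ * t := by
        linarith [mul_nonneg hN htpos.le]
end
end

section
/- There exist a bounded Borel function R : M → ℝ which is Lipschitz with constant C on every open ball whose closure is contained in M \ S, and a finite signed Borel measure sing on [0,1]² whose support is contained in S, such that ν̃(φ) = ∫_M R φ dm + sing(φ) for every continuous φ : [0,1]² → ℝ. -/
open MeasureTheory Filter Topology Set

noncomputable section

theorem isOpen_unitOpenSq : IsOpen unitOpenSq := isOpen_Ioo.prod isOpen_Ioo

theorem isCompact_unitSq : IsCompact unitSq := isCompact_Icc.prod isCompact_Icc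

theorem unitOpenSq_subset_unitSq : unitOpenSq ⊆ unitSq :=
  Set.prod_mono Ioo_subset_Icc_self Ioo_subset_Icc_self

theorem volume_unitOpenSq_lt_top : volume unitOpenSq < ⊤ :=
  (measure_mono unitOpenSq_subset_unitSq).trans_lt isCompact_unitSq.measure_lt_top

instance isFiniteMeasure_restrict_unitOpenSq :
    IsFiniteMeasure (volume.restrict unitOpenSq) :=
  ⟨by simpa using volume_unitOpenSq_lt_top⟩

/-- A weighted integral of a function that stays within `η` of `c` on the support of the
weight is within `η` times the total weight of `c` times the total weight. -/
theorem abs_integral_mul_sub_le {X : Type*} [MeasurableSpace X] {μ : Measure X}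
    {f w : X → ℝ} {c η : ℝ} (hw : ∀ x, 0 ≤ w x) (hw_int : Integrable w μ)
    (hfw_int : Integrable (fun x => f x * w x) μ)
    (hf : ∀ᵐ x ∂μ, w x ≠ 0 → |f x - c| ≤ η) :
    |(∫ x, f x * w x ∂μ) - c * ∫ x, w x ∂μ| ≤ η * ∫ x, w x ∂μ := by
  rw [← integral_const_mul, ← integral_sub hfw_int (hw_int.const_mul c), ← integral_const_mul,
    ← Real.norm_eq_abs]
  refine norm_integral_le_of_norm_le (hw_int.const_mul η) ?_
  filter_upwards [hf] with x hx
  rw [← sub_mul, norm_mul, Real.norm_eq_abs, Real.norm_eq_abs, abs_of_nonneg (hw x)]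
  rcases eq_or_ne (w x) 0 with h | h
  · simp [h]
  · exact mul_le_mul_of_nonneg_right (hx h) (hw x)

/-- A continuous cutoff vanishing where the distance to `S` is at most `1 / (k + 1)`. -/
def distCutoff (S : Set (ℝ × ℝ)) (k : ℕ) (x : ℝ × ℝ) : ℝ :=
  max 0 (min 1 ((k + 1) * Metric.infDist x S - 1))

theorem continuous_distCutoff (S : Set (ℝ × ℝ)) (k : ℕ) : Continuous (distCutoff S k) := by
  have := Metric.continuous_infDist_pt S
  unfold distCutoff
  fun_prop

theorem abs_distCutoff_le_one (S : Set (ℝ × ℝ)) (k : ℕ) (x : ℝ × ℝ) :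
    |distCutoff S k x| ≤ 1 := by
  rw [distCutoff, abs_of_nonneg (le_max_left _ _)]
  exact max_le zero_le_one (min_le_left _ _)

theorem distCutoff_eq_zero {S : Set (ℝ × ℝ)} {k : ℕ} {x : ℝ × ℝ}
    (h : Metric.infDist x S ≤ 1 / (k + 1)) : distCutoff S k x = 0 := by
  have hk : (0 : ℝ) < k + 1 := by positivity
  rw [le_div_iff₀ hk] at h
  exact max_eq_left ((min_le_right _ _).trans (by linarith))

theorem tendsto_distCutoff {S : Set (ℝ × ℝ)} (hS : IsClosed S) (hne : S.Nonempty) (x : ℝ × ℝ) :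
    Tendsto (fun k => distCutoff S k x) atTop (𝓝 (Sᶜ.indicator 1 x)) := by
  by_cases hx : x ∈ S
  · have h0 (k : ℕ) : distCutoff S k x = 0 :=
      distCutoff_eq_zero (by rw [Metric.infDist_zero_of_mem hx]; positivity)
    simp [h0, hx]
  · have hd : 0 < Metric.infDist x S := (hS.notMem_iff_infDist_pos hne).1 hx
    refine tendsto_const_nhds.congr' ?_
    obtain ⟨N, hN⟩ := exists_nat_gt (2 / Metric.infDist x S)
    rw [div_lt_iff₀ hd] at hN
    filter_upwards [eventually_ge_atTop N] with k hk
    have hk' : (N : ℝ) ≤ k := by exact_mod_cast hk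
    have : 2 ≤ (k + 1) * Metric.infDist x S := by nlinarith
    rw [distCutoff, min_eq_left (by linarith), max_eq_right zero_le_one]
    simp [hx]

/-- Multiplying by the cutoffs `distCutoff S k` localizes an integral to the complement of `S`. -/
theorem tendsto_integral_mul_distCutoff {S : Set (ℝ × ℝ)} (hS : IsClosed S) (hne : S.Nonempty)
    {μ : Measure (ℝ × ℝ)} {f : ℝ × ℝ → ℝ} (hf : Integrable f μ) :
    Tendsto (fun k => ∫ x, f x * distCutoff S k x ∂μ) atTop (𝓝 (∫ x in Sᶜ, f x ∂μ)) := by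
  rw [← integral_indicator hS.measurableSet.compl]
  refine tendsto_integral_of_dominated_convergence (fun x => ‖f x‖)
    (fun k => hf.aestronglyMeasurable.mul (continuous_distCutoff S k).aestronglyMeasurable)
    hf.norm (fun k => .of_forall fun x => ?_) (.of_forall fun x => ?_)
  · rw [norm_mul]
    exact mul_le_of_le_one_right (norm_nonneg _) (abs_distCutoff_le_one S k x)
  · convert (tendsto_distCutoff hS hne x).const_mul (f x) using 2
    by_cases hx : x ∈ S <;> simp [hx]

theorem integrable_of_bound_on_unitOpenSq {f : ℝ × ℝ → ℝ} (hf : Measurable f) {B : ℝ}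
    (hB : ∀ x ∈ unitOpenSq, |f x| ≤ B) : Integrable f (volume.restrict unitOpenSq) :=
  Integrable.of_bound hf.aestronglyMeasurable B
    ((ae_restrict_iff' isOpen_unitOpenSq.measurableSet).2 (.of_forall hB))

theorem exists_bound_on_unitSq {φ : ℝ × ℝ → ℝ} (hφ : Continuous φ) :
    ∃ B, 0 ≤ B ∧ ∀ x ∈ unitSq, |φ x| ≤ B := by
  obtain ⟨B, hB⟩ := isCompact_unitSq.exists_bound_of_continuousOn hφ.continuousOn
  exact ⟨max B 0, le_max_right _ _, fun x hx => (hB x hx).trans (le_max_left _ _)⟩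

theorem integrable_of_continuous_of_compl_unitSq {φ : ℝ × ℝ → ℝ} (hφ : Continuous φ)
    {μ : Measure (ℝ × ℝ)} [IsFiniteMeasure μ] (hμ : μ unitSqᶜ = 0) : Integrable φ μ := by
  obtain ⟨B, -, hB⟩ := exists_bound_on_unitSq hφ
  refine Integrable.of_bound hφ.aestronglyMeasurable B ?_
  filter_upwards [compl_mem_ae_iff.2 hμ] with x hx
  exact hB x (by simpa using hx)

/-- Functions which are equi-Lipschitz near `x` and whose integrals against every
continuous function converge have convergent values at `x`. -/
theorem exists_tendsto_of_tendsto_integral {D : ℕ → ℝ × ℝ → ℝ} {C δ : ℝ} {x : ℝ × ℝ}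
    (hC : 0 < C) (hD : ∀ m, Measurable (D m)) (hbdd : ∀ m, ∃ B, ∀ y ∈ unitOpenSq, |D m y| ≤ B)
    (hconv : ∀ φ : ℝ × ℝ → ℝ, Continuous φ →
      ∃ L, Tendsto (fun m => ∫ y in unitOpenSq, D m y * φ y) atTop (𝓝 L))
    (hδ : 0 < δ) (hδM : Metric.ball x δ ⊆ unitOpenSq)
    (hlip : ∀ᶠ m in atTop, ∀ y ∈ Metric.ball x δ, |D m y - D m x| ≤ C * dist y x) :
    ∃ L, Tendsto (fun m => D m x) atTop (𝓝 L) := by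
  apply cauchySeq_tendsto_of_complete
  rw [Metric.cauchySeq_iff']
  intro ε hε
  set η : ℝ := min δ (ε / (4 * C))
  have hη : 0 < η := lt_min hδ (by positivity)
  have hηC : C * η ≤ ε / 4 := by
    have : η ≤ ε / (4 * C) := min_le_right _ _
    rw [le_div_iff₀ (by positivity)] at this
    linarith
  set w : ℝ × ℝ → ℝ := fun y => max 0 (η - dist y x)
  have hw_cont : Continuous w := by fun_prop
  have hw0 (y) : 0 ≤ w y := le_max_left _ _
  have hw_le (y) : |w y| ≤ η := by
    rw [abs_of_nonneg (hw0 y)]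
    exact max_le hη.le (by linarith [dist_nonneg (x := y) (y := x)])
  have hw_ball {y} (hy : w y ≠ 0) : dist y x < η := by
    by_contra! h
    exact hy (max_eq_left (by linarith))
  have hw_int : Integrable w (volume.restrict unitOpenSq) :=
    integrable_of_bound_on_unitOpenSq hw_cont.measurable fun y _ => hw_le y
  have hDw_int (m) : Integrable (fun y => D m y * w y) (volume.restrict unitOpenSq) := by
    obtain ⟨B, hB⟩ := hbdd m
    refine integrable_of_bound_on_unitOpenSq ((hD m).mul hw_cont.measurable) (B := B * η)
      fun y hy => ?_
    rw [abs_mul]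
    exact mul_le_mul (hB y hy) (hw_le y) (abs_nonneg _) ((abs_nonneg _).trans (hB y hy))
  have hI : 0 < ∫ y in unitOpenSq, w y := by
    rw [integral_pos_iff_support_of_nonneg hw0 hw_int,
      Measure.restrict_apply (measurableSet_support hw_cont.measurable)]
    refine lt_of_lt_of_le (Metric.measure_ball_pos volume x hη) (measure_mono fun y hy => ?_)
    refine ⟨?_, hδM (Metric.ball_subset_ball (min_le_left _ _) hy)⟩
    have : dist y x < η := hy
    exact (lt_max_of_lt_right (by linarith)).ne'
  set I := ∫ y in unitOpenSq, w y
  obtain ⟨L, hL⟩ := hconv w hw_cont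
  have hclose : ∀ᶠ m in atTop, |(∫ y in unitOpenSq, D m y * w y) - L| < I * (ε / 8) :=
    (Metric.tendsto_nhds.1 hL) _ (by positivity)
  obtain ⟨N, hN⟩ := eventually_atTop.1 (hlip.and hclose)
  have hnear (m) (hm : N ≤ m) : |L - D m x * I| < (3 * ε / 8) * I := by
    have h1 : |(∫ y in unitOpenSq, D m y * w y) - D m x * I| ≤ (ε / 4) * I := by
      refine abs_integral_mul_sub_le hw0 hw_int (hDw_int m) (.of_forall fun y hy => ?_)
      have hyη := hw_ball hy
      exact ((hN m hm).1 y (hyη.trans_le (min_le_left _ _))).trans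
        ((mul_le_mul_of_nonneg_left hyη.le hC.le).trans hηC)
    have h2 := (hN m hm).2
    rw [abs_lt] at h2 ⊢
    rw [abs_le] at h1
    constructor <;> linarith
  refine ⟨N, fun n hn => ?_⟩
  have h1 := abs_lt.1 (hnear n hn)
  have h2 := abs_lt.1 (hnear N le_rfl)
  rw [Real.dist_eq, abs_lt]
  constructor <;> by_contra! h <;> nlinarith

/-- the limit measure `ν̃` (encoded as `νp − νm`) decomposes as a Lipschitz
density on `M` plus a finite signed measure (encoded as `σp − σm`) supported on `S`. -/
theorem limit_measure_decomposition
    (S : Set (ℝ × ℝ)) (hScpt : IsCompact S) (hSsub : S ⊆ unitSq)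
    (H C : ℝ) (hH : 0 < H) (hC : 0 < C)
    (s : ℕ → ℝ) (hs : ∀ m, s m ∈ Set.Ioc (0:ℝ) 1) (hs0 : Tendsto s atTop (𝓝 0))
    (Dm : ℕ → ℝ × ℝ → ℝ) (hDmeas : ∀ m, Measurable (Dm m))
    (hDL1 : ∀ m, (∫ x in unitOpenSq, |Dm m x|) ≤ C)
    (hDsup : ∀ m, ∀ x ∈ unitOpenSq, |Dm m x| ≤ C / s m)
    (hDgood : ∀ m, ∀ x ∈ unitOpenSq \ {y | Metric.infDist y S ≤ H * s m},
      DifferentiableAt ℝ (Dm m) x ∧ |Dm m x| ≤ C ∧ ‖fderiv ℝ (Dm m) x‖ ≤ C)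
    (hnbhd : ∀ r > (0:ℝ),
      volume {x ∈ unitOpenSq | Metric.infDist x S ≤ r} ≤ ENNReal.ofReal (C * r))
    (νp νm : Measure (ℝ × ℝ)) [IsFiniteMeasure νp] [IsFiniteMeasure νm]
    (hνpsupp : νp unitSqᶜ = 0) (hνmsupp : νm unitSqᶜ = 0)
    (hν : ∀ φ : ℝ × ℝ → ℝ, Continuous φ →
      Tendsto (fun m : ℕ => ∫ x in unitOpenSq, Dm m x * φ x) atTop
        (𝓝 ((∫ x, φ x ∂νp) - ∫ x, φ x ∂νm))) :
    ∃ R : ℝ × ℝ → ℝ, Measurable R ∧ (∃ B : ℝ, ∀ x ∈ unitOpenSq, |R x| ≤ B) ∧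
      (∀ (c : ℝ × ℝ) (r : ℝ), closure (Metric.ball c r) ⊆ unitOpenSq \ S →
        LipschitzOnWith (Real.toNNReal C) R (Metric.ball c r)) ∧
      ∃ σp σm : Measure (ℝ × ℝ), IsFiniteMeasure σp ∧ IsFiniteMeasure σm ∧
        σp Sᶜ = 0 ∧ σm Sᶜ = 0 ∧
        ∀ φ : ℝ × ℝ → ℝ, Continuous φ →
          (∫ x, φ x ∂νp) - (∫ x, φ x ∂νm) =
            (∫ x in unitOpenSq, R x * φ x) + ((∫ x, φ x ∂σp) - ∫ x, φ x ∂σm) := by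
  have hne : S.Nonempty := by
    rw [nonempty_iff_ne_empty]
    rintro rfl
    have hpos : 0 < volume unitOpenSq :=
      isOpen_unitOpenSq.measure_pos _ ⟨(1 / 2, 1 / 2), by norm_num [unitOpenSq]⟩
    have hle (r : ℝ) (hr : 0 < r) : volume unitOpenSq ≤ ENNReal.ofReal (C * r) := by
      simpa [Metric.infDist_empty, hr.le] using hnbhd r hr
    have hreal : 0 < (volume unitOpenSq).toReal :=
      ENNReal.toReal_pos hpos.ne' volume_unitOpenSq_lt_top.ne
    have h := hle ((volume unitOpenSq).toReal / (2 * C)) (by positivity)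
    rw [ENNReal.le_ofReal_iff_toReal_le volume_unitOpenSq_lt_top.ne (by positivity)] at h
    field_simp at h
    linarith
  have hScl := hScpt.isClosed
  have hHs : Tendsto (fun m => H * s m) atTop (𝓝 0) := by simpa using hs0.const_mul H
  have hfar (d : ℝ) (hd : 0 < d) : ∀ᶠ m in atTop, H * s m < d := hHs.eventually_lt_const hd
  have hgood (d : ℝ) (hd : 0 < d) : ∀ᶠ m in atTop, ∀ x ∈ unitOpenSq, d ≤ Metric.infDist x S →
      DifferentiableAt ℝ (Dm m) x ∧ |Dm m x| ≤ C ∧ ‖fderiv ℝ (Dm m) x‖ ≤ C := by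
    filter_upwards [hfar d hd] with m hm x hx hxd
    exact hDgood m x ⟨hx, fun h => by simp only [mem_ofPred_eq] at h; linarith⟩
  have hlip (d : ℝ) (hd : 0 < d) (U : Set (ℝ × ℝ)) (hU : Convex ℝ U) (hUM : U ⊆ unitOpenSq)
      (hUd : ∀ x ∈ U, d ≤ Metric.infDist x S) :
      ∀ᶠ m in atTop, ∀ x ∈ U, ∀ y ∈ U, |Dm m y - Dm m x| ≤ C * dist y x := by
    filter_upwards [hgood d hd] with m hm x hx y hy
    rw [dist_eq_norm]
    exact hU.norm_image_sub_le_of_norm_fderiv_le (fun z hz => (hm z (hUM hz) (hUd z hz)).1)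
      (fun z hz => (hm z (hUM hz) (hUd z hz)).2.2) hx hy
  have hpt (x) (hx : x ∈ unitOpenSq \ S) : ∃ L, Tendsto (fun m => Dm m x) atTop (𝓝 L) := by
    have hd : 0 < Metric.infDist x S := (hScl.notMem_iff_infDist_pos hne).1 hx.2
    obtain ⟨ρ, hρ, hρM⟩ := Metric.isOpen_iff.1 isOpen_unitOpenSq x hx.1
    have hδ : 0 < min ρ (Metric.infDist x S / 2) := lt_min hρ (half_pos hd)
    have hδM := (Metric.ball_subset_ball (x := x) (min_le_left ρ (Metric.infDist x S / 2))).trans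
      hρM
    refine exists_tendsto_of_tendsto_integral hC hDmeas (fun m => ⟨_, hDsup m⟩)
      (fun φ hφ => ⟨_, hν φ hφ⟩) hδ hδM ?_
    have hUd (y) (hy : y ∈ Metric.ball x (min ρ (Metric.infDist x S / 2))) :
        Metric.infDist x S / 2 ≤ Metric.infDist y S := by
      have h1 : dist y x < Metric.infDist x S / 2 := lt_of_lt_of_le hy (min_le_right _ _)
      have h2 := Metric.infDist_le_infDist_add_dist (s := S) (x := x) (y := y)
      rw [dist_comm] at h2
      linarith
    filter_upwards [hlip _ (half_pos hd) _ (convex_ball x _) hδM hUd] with m hm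
    exact hm x (Metric.mem_ball_self hδ)
  choose! L hL using hpt
  have hmeas_diff : MeasurableSet (unitOpenSq \ S) :=
    isOpen_unitOpenSq.measurableSet.diff hScl.measurableSet
  set R : ℝ × ℝ → ℝ := (unitOpenSq \ S).indicator L with hR_def
  have hR_lim (x) (hx : x ∈ unitOpenSq \ S) : Tendsto (fun m => Dm m x) atTop (𝓝 (R x)) := by
    rw [hR_def, indicator_of_mem hx]
    exact hL x hx
  have hR_zero (x) (hx : x ∈ S) : R x = 0 := indicator_of_notMem (fun h => h.2 hx) _
  have hR_meas : Measurable R := by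
    refine measurable_of_tendsto_metrizable
      (f := fun m => (unitOpenSq \ S).indicator (Dm m)) (fun m => (hDmeas m).indicator hmeas_diff)
      (tendsto_pi_nhds.2 fun x => ?_)
    by_cases hx : x ∈ unitOpenSq \ S
    · simpa [indicator_of_mem hx] using hR_lim x hx
    · simp [hR_def, indicator_of_notMem hx]
  have hR_le (x) : |R x| ≤ C := by
    by_cases hx : x ∈ unitOpenSq \ S
    · refine le_of_tendsto (hR_lim x hx).abs ?_
      have hd : 0 < Metric.infDist x S := (hScl.notMem_iff_infDist_pos hne).1 hx.2
      filter_upwards [hgood _ hd] with m hm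
      exact (hm x hx.1 le_rfl).2.1
    · simp [hR_def, indicator_of_notMem hx, hC.le]
  refine ⟨R, hR_meas, ⟨C, fun x _ => hR_le x⟩, fun c r hcr => ?_, νp.restrict S, νm.restrict S,
    inferInstance, inferInstance, by simp [hScl.measurableSet.compl],
    by simp [hScl.measurableSet.compl], fun φ hφ => ?_⟩
  · refine LipschitzOnWith.of_dist_le_mul fun x hx y hy => ?_
    rw [Real.coe_toNNReal C hC.le, Real.dist_eq]
    have hsub := subset_closure.trans hcr
    obtain ⟨z, hz, hzmin⟩ := (isCompact_closedBall c r |>.of_isClosed_subset isClosed_closure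
      Metric.closure_ball_subset_closedBall).exists_isMinOn ⟨x, subset_closure hx⟩
      (Metric.continuous_infDist_pt S).continuousOn
    refine le_of_tendsto ((hR_lim x (hsub hx)).sub (hR_lim y (hsub hy))).abs ?_
    filter_upwards [hlip _ ((hScl.notMem_iff_infDist_pos hne).1 (hcr hz).2) _ (convex_ball c r)
      (hsub.trans sdiff_subset) fun y hy => hzmin (subset_closure hy)] with m hm
    exact hm y hy x hx
  have hcut (k : ℕ) : (∫ x, φ x * distCutoff S k x ∂νp) - ∫ x, φ x * distCutoff S k x ∂νm =
      ∫ x in unitOpenSq, R x * φ x * distCutoff S k x := by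
    refine tendsto_nhds_unique (hν _ (hφ.mul (continuous_distCutoff S k))) ?_
    obtain ⟨B, hB0, hB⟩ := exists_bound_on_unitSq hφ
    simp_rw [mul_assoc]
    refine tendsto_integral_filter_of_dominated_convergence (fun _ => C * B)
      (.of_forall fun m => ((hDmeas m).mul
        (hφ.mul (continuous_distCutoff S k)).measurable).aestronglyMeasurable)
      ?_ (integrable_const _) ?_
    · filter_upwards [hgood (1 / (k + 1)) (by positivity)] with m hm
      rw [ae_restrict_iff' isOpen_unitOpenSq.measurableSet]
      refine .of_forall fun x hx => ?_
      rcases le_total (Metric.infDist x S) (1 / (k + 1)) with h | h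
      · rw [distCutoff_eq_zero h]
        simp only [mul_zero, norm_zero]
        positivity
      · rw [norm_mul, norm_mul]
        refine mul_le_mul (hm x hx h).2.1 ?_ (by positivity) hC.le
        exact (mul_le_of_le_one_right (norm_nonneg _) (abs_distCutoff_le_one S k x)).trans
          (hB x (unitOpenSq_subset_unitSq hx))
    · rw [ae_restrict_iff' isOpen_unitOpenSq.measurableSet]
      refine .of_forall fun x hx => ?_
      by_cases hxS : x ∈ S
      · have h0 : distCutoff S k x = 0 :=
          distCutoff_eq_zero (by rw [Metric.infDist_zero_of_mem hxS]; positivity)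
        simp [h0]
      · exact (hR_lim x ⟨hx, hxS⟩).mul_const _
  have hRφ_int : Integrable (fun x => R x * φ x) (volume.restrict unitOpenSq) := by
    obtain ⟨B, hB0, hB⟩ := exists_bound_on_unitSq hφ
    refine integrable_of_bound_on_unitOpenSq (hR_meas.mul hφ.measurable) (B := C * B)
      fun x hx => ?_
    rw [abs_mul]
    exact mul_le_mul (hR_le x) (hB x (unitOpenSq_subset_unitSq hx)) (abs_nonneg _) hC.le
  have hp_int := integrable_of_continuous_of_compl_unitSq hφ hνpsupp
  have hm_int := integrable_of_continuous_of_compl_unitSq hφ hνmsupp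
  have hcompl : (∫ x in Sᶜ, φ x ∂νp) - ∫ x in Sᶜ, φ x ∂νm =
      ∫ x in Sᶜ, R x * φ x ∂(volume.restrict unitOpenSq) := by
    refine tendsto_nhds_unique ((tendsto_integral_mul_distCutoff hScl hne hp_int).sub
      (tendsto_integral_mul_distCutoff hScl hne hm_int)) ?_
    simp_rw [hcut]
    exact tendsto_integral_mul_distCutoff hScl hne hRφ_int
  have hR_compl : ∫ x in Sᶜ, R x * φ x ∂(volume.restrict unitOpenSq) =
      ∫ x in unitOpenSq, R x * φ x :=
    setIntegral_eq_integral_of_forall_compl_eq_zero fun x hx => by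
      rw [hR_zero x (by simpa using hx), zero_mul]
  rw [← hR_compl, ← hcompl, ← integral_add_compl hScl.measurableSet hp_int,
    ← integral_add_compl hScl.measurableSet hm_int]
  ring
end
end

section
/- For every x ∈ F(U) ∩ G(U) one has |F^{−1}(x) − G^{−1}(x)| ≤ Q D t; if moreover D Q t ≤ 1/2, then also ‖D(F^{−1})(x) − D(G^{−1})(x)‖ ≤ D²(D+2) Q t. -/
open Set Metric

noncomputable section

abbrev E2 := EuclideanSpace ℝ (Fin 2)

/-- The chain rule for a local left inverse. -/
theorem fderiv_comp_fderiv_eq_id_of_leftInvOn {E H : Type*} [NormedAddCommGroup E]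
    [NormedSpace ℝ E] [NormedAddCommGroup H] [NormedSpace ℝ H] {f : E → H} {g : H → E} {s : Set E}
    (hs : IsOpen s) (hgf : LeftInvOn g f s) {x : E} (hx : x ∈ s) (hf : DifferentiableAt ℝ f x)
    (hg : DifferentiableAt ℝ g (f x)) :
    (fderiv ℝ g (f x)).comp (fderiv ℝ f x) = ContinuousLinearMap.id ℝ E := by
  rw [← fderiv_comp x hg hf, ← fderiv_id (𝕜 := ℝ) (x := x)]
  apply Filter.EventuallyEq.fderiv_eq
  filter_upwards [hs.mem_nhds hx] with y hy using hgf hy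

/-- If `P` is a left inverse of `A` and `R` a right inverse of `B`, then `P - R` is controlled by
`A - B`. -/
theorem norm_leftInverse_sub_rightInverse_le {E H : Type*} [NormedAddCommGroup E]
    [NormedSpace ℝ E] [NormedAddCommGroup H] [NormedSpace ℝ H] {A B : E →L[ℝ] H} {P R : H →L[ℝ] E}
    (hP : P.comp A = ContinuousLinearMap.id ℝ E) (hR : B.comp R = ContinuousLinearMap.id ℝ H) :
    ‖P - R‖ ≤ ‖P‖ * ‖A - B‖ * ‖R‖ := by
  have key : P - R = -((P.comp (A - B)).comp R) := by
    rw [ContinuousLinearMap.comp_sub, hP, ContinuousLinearMap.sub_comp,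
      ContinuousLinearMap.comp_assoc, hR, ContinuousLinearMap.id_comp,
      ContinuousLinearMap.comp_id, neg_sub]
  rw [key, norm_neg]
  refine (ContinuousLinearMap.opNorm_comp_le _ _).trans ?_
  gcongr
  exact ContinuousLinearMap.opNorm_comp_le _ _

/-- On a convex open set `s`, the map `φ ∘ f` is Lipschitz as soon as `f` has bounded derivative on
`s` and `φ` has bounded derivative on `f '' s`; convexity of `f '' s` is not needed. -/
theorem norm_comp_sub_comp_le_of_norm_fderiv_le {E H W : Type*} [NormedAddCommGroup E]
    [NormedSpace ℝ E] [NormedAddCommGroup H] [NormedSpace ℝ H] [NormedAddCommGroup W]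
    [NormedSpace ℝ W] {f : E → H} {φ : H → W} {s : Set E} {C K : ℝ} (hs : Convex ℝ s)
    (hf : ∀ x ∈ s, DifferentiableAt ℝ f x) (hφ : ∀ x ∈ s, DifferentiableAt ℝ φ (f x))
    (hC : ∀ x ∈ s, ‖fderiv ℝ f x‖ ≤ C) (hK : ∀ x ∈ s, ‖fderiv ℝ φ (f x)‖ ≤ K)
    {a b : E} (ha : a ∈ s) (hb : b ∈ s) :
    ‖φ (f a) - φ (f b)‖ ≤ K * C * ‖a - b‖ := by
  refine hs.norm_image_sub_le_of_norm_fderiv_le (f := φ ∘ f) (𝕜 := ℝ)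
    (fun x hx => (hφ x hx).comp x (hf x hx)) (fun x hx => ?_) hb ha
  rw [fderiv_comp x (hφ x hx) (hf x hx)]
  refine (ContinuousLinearMap.opNorm_comp_le _ _).trans ?_
  exact mul_le_mul (hK x hx) (hC x hx) (norm_nonneg _) ((norm_nonneg _).trans (hK x hx))

/-- closeness of the inverses of two close `C²` diffeomorphisms. -/
theorem inverses_are_close
    (c₀ : E2) (r₀ : ℝ) (hr₀ : 0 < r₀)
    (D Q t : ℝ) (hD : 0 < D) (hQ : 0 < Q) (ht : 0 < t)
    (F G Finv Ginv : E2 → E2)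
    (hFopen : IsOpen (F '' ball c₀ r₀)) (hGopen : IsOpen (G '' ball c₀ r₀))
    (hF : ContDiffOn ℝ 2 F (ball c₀ r₀)) (hG : ContDiffOn ℝ 2 G (ball c₀ r₀))
    (hFinv : ContDiffOn ℝ 2 Finv (F '' ball c₀ r₀))
    (hGinv : ContDiffOn ℝ 2 Ginv (G '' ball c₀ r₀))
    (hFl : ∀ x ∈ ball c₀ r₀, Finv (F x) = x)
    (hFr : ∀ y ∈ F '' ball c₀ r₀, F (Finv y) = y)
    (hGl : ∀ x ∈ ball c₀ r₀, Ginv (G x) = x)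
    (hGr : ∀ y ∈ G '' ball c₀ r₀, G (Ginv y) = y)
    (hFbnd : ∀ x ∈ ball c₀ r₀,
      ‖F x‖ ≤ D ∧ ‖fderiv ℝ F x‖ ≤ D ∧ ‖fderiv ℝ (fderiv ℝ F) x‖ ≤ D)
    (hGbnd : ∀ x ∈ ball c₀ r₀,
      ‖G x‖ ≤ D ∧ ‖fderiv ℝ G x‖ ≤ D ∧ ‖fderiv ℝ (fderiv ℝ G) x‖ ≤ D)
    (hFinvbnd : ∀ y ∈ F '' ball c₀ r₀,
      ‖Finv y‖ ≤ D ∧ ‖fderiv ℝ Finv y‖ ≤ D ∧ ‖fderiv ℝ (fderiv ℝ Finv) y‖ ≤ D)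
    (hGinvbnd : ∀ y ∈ G '' ball c₀ r₀,
      ‖Ginv y‖ ≤ D ∧ ‖fderiv ℝ Ginv y‖ ≤ D ∧ ‖fderiv ℝ (fderiv ℝ Ginv) y‖ ≤ D)
    (hFG : ∀ x ∈ ball c₀ r₀, ‖F x - G x‖ ≤ Q * t ∧
      ‖fderiv ℝ F x - fderiv ℝ G x‖ ≤ Q * t ∧
      ‖fderiv ℝ (fderiv ℝ F) x - fderiv ℝ (fderiv ℝ G) x‖ ≤ Q * t)
    (hlow : ∀ a ∈ ball c₀ r₀, ∀ b ∈ ball c₀ r₀, D⁻¹ * ‖a - b‖ ≤ ‖F a - F b‖) :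
    ∀ x ∈ F '' ball c₀ r₀ ∩ G '' ball c₀ r₀,
      ‖Finv x - Ginv x‖ ≤ Q * D * t ∧
      (D * Q * t ≤ 1 / 2 → ‖fderiv ℝ Finv x - fderiv ℝ Ginv x‖ ≤ D ^ 2 * (D + 2) * Q * t) := by
  rintro x ⟨⟨a, ha, rfl⟩, ⟨b, hb, hba⟩⟩
  have hab : ‖a - b‖ ≤ Q * D * t := by
    have h := hlow a ha b hb
    rw [← hba, norm_sub_rev (G b), inv_mul_le_iff₀ hD] at h
    calc ‖a - b‖ ≤ D * ‖F b - G b‖ := h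
      _ ≤ D * (Q * t) := by gcongr; exact (hFG b hb).1
      _ = Q * D * t := by ring
  have hGa : Ginv (F a) = b := by rw [← hba, hGl b hb]
  refine ⟨by rwa [hFl a ha, hGa], fun _ => ?_⟩
  have hFd : ∀ y ∈ ball c₀ r₀, DifferentiableAt ℝ F y := fun y hy =>
    (hF.differentiableOn (by norm_num)).differentiableAt (isOpen_ball.mem_nhds hy)
  have hGd : ∀ y ∈ ball c₀ r₀, DifferentiableAt ℝ G y := fun y hy =>
    (hG.differentiableOn (by norm_num)).differentiableAt (isOpen_ball.mem_nhds hy)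
  have hFid : ∀ y ∈ F '' ball c₀ r₀, DifferentiableAt ℝ Finv y := fun y hy =>
    (hFinv.differentiableOn (by norm_num)).differentiableAt (hFopen.mem_nhds hy)
  have hGid : ∀ y ∈ G '' ball c₀ r₀, DifferentiableAt ℝ Ginv y := fun y hy =>
    (hGinv.differentiableOn (by norm_num)).differentiableAt (hGopen.mem_nhds hy)
  have hFid2 : ∀ y ∈ F '' ball c₀ r₀, DifferentiableAt ℝ (fderiv ℝ Finv) y := fun y hy =>
    ((hFinv.fderiv_of_isOpen (m := 1) hFopen (by norm_num)).differentiableOn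
      (by norm_num)).differentiableAt (hFopen.mem_nhds hy)
  have hFb := mem_image_of_mem F hb
  have hGb := mem_image_of_mem G hb
  have hpath : ‖fderiv ℝ Finv (F a) - fderiv ℝ Finv (F b)‖ ≤ D * D * (Q * D * t) :=
    (norm_comp_sub_comp_le_of_norm_fderiv_le (convex_ball c₀ r₀) hFd
      (fun y hy => hFid2 _ (mem_image_of_mem F hy)) (fun y hy => (hFbnd y hy).2.1)
      (fun y hy => (hFinvbnd _ (mem_image_of_mem F hy)).2.2) ha hb).trans (by gcongr)
  have hP := fderiv_comp_fderiv_eq_id_of_leftInvOn isOpen_ball hFl hb (hFd b hb) (hFid _ hFb)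
  have hR : (fderiv ℝ G b).comp (fderiv ℝ Ginv (G b)) = ContinuousLinearMap.id ℝ E2 := by
    have h := fderiv_comp_fderiv_eq_id_of_leftInvOn hGopen hGr hGb (hGid _ hGb)
      (by rw [hGl b hb]; exact hGd b hb)
    rwa [hGl b hb] at h
  have hpoint : ‖fderiv ℝ Finv (F b) - fderiv ℝ Ginv (G b)‖ ≤ D * (Q * t) * D := by
    refine (norm_leftInverse_sub_rightInverse_le hP hR).trans ?_
    gcongr
    · exact (hFinvbnd _ hFb).2.1
    · exact (hFG b hb).2.1
    · exact (hGinvbnd _ hGb).2.1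
  rw [hba] at hpoint
  have htri := norm_sub_le_norm_sub_add_norm_sub (fderiv ℝ Finv (F a)) (fderiv ℝ Finv (F b))
    (fderiv ℝ Ginv (F a))
  have hpos : 0 ≤ D ^ 2 * (Q * t) := by positivity
  linarith
end
end

section
/- If A △ B ⊆ {x : dist(x, frontier A) ≤ r} ∩ {x : dist(x, frontier B) ≤ r}, then frontier B ⊆ {x : dist(x, frontier A) ≤ r} and frontier A ⊆ {x : dist(x, frontier B) ≤ r}; in particular the Hausdorff distance between frontier A and frontier B is at most r. -/
open Set Metric

/-- A frontier point of an open set `B` is a frontier point of `A` or a limit of points of the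
symmetric difference. -/
theorem IsOpen.frontier_subset_frontier_union_closure {X : Type*} [TopologicalSpace X]
    {A B : Set X} (hB : IsOpen B) :
    frontier B ⊆ frontier A ∪ closure ((A \ B) ∪ (B \ A)) := by
  intro x hx
  rw [hB.frontier_eq] at hx
  by_cases hxA : x ∈ A
  · exact Or.inr (subset_closure (Or.inl ⟨hxA, hx.2⟩))
  · have hx' : x ∈ closure (B ∩ A) ∪ closure (B \ A) := by
      rw [← closure_union, inter_union_sdiff]
      exact hx.1
    rcases hx' with h | h
    · exact Or.inl ⟨closure_mono inter_subset_right h, fun hi => hxA (interior_subset hi)⟩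
    · exact Or.inr (closure_mono subset_union_right h)

theorem IsOpen.infDist_frontier_le_of_symmDiff_subset {X : Type*} [PseudoMetricSpace X]
    {A B : Set X} (hB : IsOpen B) {r : ℝ} (hr : 0 ≤ r)
    (h : (A \ B) ∪ (B \ A) ⊆ {x | infDist x (frontier A) ≤ r}) :
    frontier B ⊆ {x | infDist x (frontier A) ≤ r} := by
  refine (hB.frontier_subset_frontier_union_closure (A := A)).trans
    (union_subset (fun x hx => ?_) ?_)
  · exact (infDist_zero_of_mem hx).trans_le hr
  · exact closure_minimal h (isClosed_le (continuous_infDist_pt _) continuous_const)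

/-- if the symmetric difference of two open sets lies in the `r`-neighbourhoods
of both frontiers, then each frontier lies in the `r`-neighbourhood of the other, and the
Hausdorff distance between the frontiers is at most `r`. -/
theorem frontier_hausdorff_close_of_symmDiff
    {X : Type*} [MetricSpace X] (A B : Set X) (hA : IsOpen A) (hB : IsOpen B)
    (hfA : (frontier A).Nonempty) (hfB : (frontier B).Nonempty)
    (r : ℝ) (hr : 0 < r)
    (hsub : (A \ B) ∪ (B \ A) ⊆
      {x | Metric.infDist x (frontier A) ≤ r} ∩ {x | Metric.infDist x (frontier B) ≤ r}) :
    frontier B ⊆ {x | Metric.infDist x (frontier A) ≤ r} ∧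
    frontier A ⊆ {x | Metric.infDist x (frontier B) ≤ r} ∧
    Metric.hausdorffDist (frontier A) (frontier B) ≤ r := by
  have hBA := hB.infDist_frontier_le_of_symmDiff_subset hr.le (hsub.trans inter_subset_left)
  have hAB := hA.infDist_frontier_le_of_symmDiff_subset hr.le
    ((union_comm _ _).trans_subset (hsub.trans inter_subset_right))
  exact ⟨hBA, hAB, hausdorffDist_le_of_infDist hr.le hAB hBA⟩
end

section
/- If y ∈ A and F_t(y) ∉ F₀(A), then dist(y, frontier A) ≤ 2 D Q t. -/
open Set Metric

noncomputable section

/-- A continuous function on a connected space whose exponential is constant is constant. -/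
theorem eq_of_exp_eq_const {X : Type*} [TopologicalSpace X] [PreconnectedSpace X] {h : X → ℂ}
    (hh : Continuous h) {c : ℂ} (hc : ∀ x, Complex.exp (h x) = c) (x y : X) : h x = h y := by
  have := Complex.isCoveringMap_exp.eq_of_comp_eq hh (continuous_const (y := h y))
    (funext fun z ↦ Subtype.ext ((hc z).trans (hc y).symm)) y rfl
  exact congrFun this x

theorem exists_continuous_log {X : Type*} [TopologicalSpace X] [SimplyConnectedSpace X]
    [LocallyPathConnectedSpace X] {g : X → ℂ} (hg : Continuous g) (h0 : ∀ x, g x ≠ 0) :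
    ∃ L : X → ℂ, Continuous L ∧ ∀ x, Complex.exp (L x) = g x := by
  obtain ⟨x₀⟩ : Nonempty X := inferInstance
  obtain ⟨L, ⟨-, hL⟩, -⟩ := Complex.isCoveringMapOn_exp.existsUnique_continuousMap_lifts
    ⟨g, hg⟩ (a₀ := x₀) (Complex.exp_log (h0 x₀)) h0
  exact ⟨L, L.continuous, congrFun hL⟩

/-- An odd loop in the punctured plane is not freely homotopic to a constant loop. -/
theorem not_exists_homotopy_const_odd (G : ℝ × ℝ → ℂ) (hG : Continuous G) (h0 : ∀ x, G x ≠ 0)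
    {T a b : ℝ} {c : ℂ} (hper : ∀ θ s, G (θ + 2 * T, s) = G (θ, s)) (ha : ∀ θ, G (θ, a) = c)
    (hb : ∀ θ, G (θ + T, b) = -G (θ, b)) : False := by
  obtain ⟨L, hL, hexp⟩ := exists_continuous_log hG h0
  have hconst : L (2 * T, a) = L (0, a) :=
    eq_of_exp_eq_const (h := fun θ ↦ L (θ, a)) (by fun_prop)
      (fun θ ↦ (hexp _).trans (ha θ)) (2 * T) 0
  have hshift : L (2 * T, b) - L (0, b) = L (2 * T, a) - L (0, a) := by
    refine eq_of_exp_eq_const (h := fun s ↦ L (2 * T, s) - L (0, s)) (c := 1) (by fun_prop)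
      (fun s ↦ ?_) b a
    have := hper 0 s
    rw [zero_add] at this
    rw [Complex.exp_sub, hexp, hexp, this, div_self (h0 _)]
  have hhalf (θ : ℝ) : Complex.exp (L (θ + T, b) - L (θ, b)) = -1 := by
    rw [Complex.exp_sub, hexp, hexp, hb, neg_div, div_self (h0 _)]
  have heq := eq_of_exp_eq_const (h := fun θ ↦ L (θ + T, b) - L (θ, b)) (by fun_prop) hhalf T 0
  have hTT : T + T = 2 * T := by ring
  simp only [hTT, zero_add] at heq
  have hz : L (T, b) - L (0, b) = 0 := by linear_combination (hshift + hconst - heq) / 2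
  have := hhalf 0
  rw [zero_add, hz, Complex.exp_zero] at this
  norm_num at this

/-- A quantitative form of invariance of domain in the plane. -/
theorem mem_image_closedBall_of_injOn {F : ℂ → ℂ} {r : ℝ} {p : ℂ} (hr : 0 < r)
    (hF : ContinuousOn F (closedBall 0 r)) (hinj : InjOn F (closedBall 0 r))
    (hp : ∀ z, ‖z‖ = r → ‖F 0 - p‖ < ‖F z - F 0‖) : p ∈ F '' closedBall 0 r := by
  by_contra hmem
  let k : ℝ → ℝ := fun s ↦ max 0 (min 1 s)
  have hk : Continuous k := by fun_prop
  have hk0 s : 0 ≤ k s := le_max_left _ _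
  have hk1 s : k s ≤ 1 := max_le zero_le_one (min_le_left _ _)
  have hkz {s : ℝ} (hs : s ≤ 0) : k s = 0 := max_eq_left (min_le_of_right_le hs)
  have hko {s : ℝ} (hs : 1 ≤ s) : k s = 1 := by simp [k, hs]
  let x : ℝ → ℂ := fun θ ↦ r * Complex.exp (θ * Complex.I)
  have hx : Continuous x := by fun_prop
  have hxr θ : ‖x θ‖ = r := by simp [x, Complex.norm_exp_ofReal_mul_I, hr.le]
  have hxpi θ : x (θ + Real.pi) = -x θ := by
    simp [x, add_mul, Complex.exp_add, Complex.exp_pi_mul_I]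
  have hxper θ : x (θ + 2 * Real.pi) = x θ := by
    rw [two_mul, ← add_assoc, hxpi, hxpi, neg_neg]
  -- the two arguments of `F` in the homotopy
  let A : ℝ × ℝ → ℂ := fun q ↦ ((k q.2 / (1 + k (q.2 - 2)) : ℝ) : ℂ) * x q.1
  let B : ℝ × ℝ → ℂ := fun q ↦ ((-(k (q.2 - 2) / (1 + k (q.2 - 2))) : ℝ) : ℂ) * x q.1
  have hden s : 0 < 1 + k s := by linarith [hk0 s]
  have hAc : Continuous A := by
    refine (Complex.continuous_ofReal.comp (Continuous.div (by fun_prop) (by fun_prop)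
      fun q ↦ (hden _).ne')).mul (by fun_prop)
  have hBc : Continuous B := by
    refine (Complex.continuous_ofReal.comp (Continuous.div (by fun_prop) (by fun_prop)
      fun q ↦ (hden _).ne').neg).mul (by fun_prop)
  have hball (m θ : ℝ) (hm : |m| ≤ 1) : (m : ℂ) * x θ ∈ closedBall (0 : ℂ) r := by
    rw [mem_closedBall_zero_iff, norm_mul, hxr, Complex.norm_real, Real.norm_eq_abs]
    exact mul_le_of_le_one_left hr.le hm
  have hAm q : A q ∈ closedBall (0 : ℂ) r := by
    refine hball _ _ ?_
    rw [abs_of_nonneg (div_nonneg (hk0 _) (hden _).le), div_le_one (hden _)]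
    linarith [hk1 q.2, hk0 (q.2 - 2)]
  have hBm q : B q ∈ closedBall (0 : ℂ) r := by
    refine hball _ _ ?_
    rw [abs_neg, abs_of_nonneg (div_nonneg (hk0 _) (hden _).le), div_le_one (hden _)]
    linarith
  refine not_exists_homotopy_const_odd
    (fun q ↦ F (A q) - F (B q) + ((1 - k (q.2 - 1) : ℝ) : ℂ) * (F 0 - p))
    (((hF.comp_continuous hAc hAm).sub (hF.comp_continuous hBc hBm)).add (by fun_prop))
    ?_ (T := Real.pi) (a := 0) (b := 3) (c := F 0 - p) ?_ ?_ ?_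
  · rintro ⟨θ, s⟩ h
    dsimp only at h
    rcases le_total s 2 with hs2 | hs2
    · have hB0 : B (θ, s) = 0 := by simp [B, hkz (sub_nonpos.2 hs2)]
      rw [hB0] at h
      rcases le_total s 1 with hs1 | hs1
      · rw [hkz (sub_nonpos.2 hs1)] at h
        refine hmem ⟨A (θ, s), hAm _, ?_⟩
        push_cast at h
        linear_combination h
      · have hA : A (θ, s) = x θ := by simp [A, hkz (sub_nonpos.2 hs2), hko hs1]
        rw [hA] at h
        have hlt := hp _ (hxr θ)
        rw [eq_neg_of_add_eq_zero_left h, norm_neg, norm_mul, Complex.norm_real,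
          Real.norm_of_nonneg (by linarith [hk1 (s - 1)])] at hlt
        nlinarith [hk0 (s - 1), norm_nonneg (F 0 - p)]
    · rw [hko (by linarith : 1 ≤ s - 1)] at h
      have hAB : A (θ, s) = B (θ, s) :=
        hinj (hAm _) (hBm _) (by simpa [sub_eq_zero] using h)
      have hxne : x θ ≠ 0 := norm_ne_zero_iff.1 (by rw [hxr]; exact hr.ne')
      have := Complex.ofReal_injective (mul_right_cancel₀ hxne hAB)
      dsimp only at this
      have h1 : 0 < k s / (1 + k (s - 2)) := by
        rw [hko (by linarith : 1 ≤ s)]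
        exact div_pos one_pos (hden _)
      have h2 := div_nonneg (hk0 (s - 2)) (hden (s - 2)).le
      linarith
  · intro θ s
    simp only [A, B, hxper]
  · intro θ
    simp [A, B, hkz (show (0 : ℝ) ≤ 0 from le_rfl), hkz (show (0 - 2 : ℝ) ≤ 0 by norm_num),
      hkz (show (0 - 1 : ℝ) ≤ 0 by norm_num), -zero_sub]
  · intro θ
    have h3 : k 3 = 1 := hko (by norm_num)
    have h2 : k (3 - 1) = 1 := hko (by norm_num)
    have h1 : k (3 - 2) = 1 := hko (by norm_num)
    simp only [A, B, hxpi, h1, h2, h3]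
    push_cast
    ring_nf

theorem closedBall_subset_of_lt_infDist_frontier {E : Type*} [NormedAddCommGroup E]
    [NormedSpace ℝ E] {A : Set E} {y : E} {r : ℝ} (hA : IsOpen A) (hy : y ∈ A) (hr : 0 ≤ r)
    (h : r < infDist y (frontier A)) : closedBall y r ⊆ A := by
  have hdisj (z : E) (hz : z ∈ closedBall y r) : z ∉ frontier A := fun hzf ↦
    h.not_ge ((infDist_le_dist_of_mem hzf).trans (by rwa [dist_comm]))
  refine (convex_closedBall y r).isPreconnected.subset_left_of_subset_union hA
    isClosed_closure.isOpen_compl (disjoint_compl_right.mono_right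
      (compl_subset_compl.2 subset_closure)) (fun z hz ↦ ?_) ⟨y, mem_closedBall_self hr, hy⟩
  by_contra hn
  rw [mem_union, not_or, notMem_compl_iff] at hn
  exact hdisj z hz (by rw [hA.frontier_eq]; exact ⟨hn.2, hn.1⟩)

/-- a point of `A` whose perturbed image escapes `F₀(A)` is `2DQt`-close to the
frontier of `A`. -/
theorem near_frontier_of_escape
    (U A : Set E2) (hU : IsOpen U) (hA : IsOpen A)
    (hAcl : IsCompact (closure A)) (hAU : closure A ⊆ U)
    (D Q t : ℝ) (hD : 0 < D) (hQ : 0 < Q) (ht : 0 < t)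
    (F₀ Ft : E2 → E2)
    (hF₀cont : ContinuousOn F₀ U) (hF₀inj : Set.InjOn F₀ U)
    (hlow : ∀ a ∈ U, ∀ b ∈ U, D⁻¹ * ‖a - b‖ ≤ ‖F₀ a - F₀ b‖)
    (hFt : ∀ x ∈ U, ‖Ft x - F₀ x‖ ≤ Q * t) :
    ∀ y ∈ A, Ft y ∉ F₀ '' A → Metric.infDist y (frontier A) ≤ 2 * D * Q * t := by
  intro y hy hesc
  by_contra! hlt
  have hr : 0 < 2 * D * Q * t := by positivity
  have hball := closedBall_subset_of_lt_infDist_frontier hA hy hr.le hlt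
  have hAU' : A ⊆ U := subset_closure.trans hAU
  let e : ℂ ≃ₗᵢ[ℝ] E2 := Complex.orthonormalBasisOneI.repr
  have hmaps : MapsTo (fun z ↦ y + e z) (closedBall 0 (2 * D * Q * t)) A := fun z hz ↦
    hball (by simpa using hz)
  obtain ⟨z, hz, hFz⟩ := mem_image_closedBall_of_injOn (F := fun z ↦ e.symm (F₀ (y + e z)))
    (p := e.symm (Ft y)) hr
    (e.symm.continuous.comp_continuousOn
      ((hF₀cont.mono hAU').comp (by fun_prop) hmaps))
    (fun a ha b hb hab ↦ by
      simpa using hF₀inj (hAU' (hmaps ha)) (hAU' (hmaps hb)) (e.symm.injective hab))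
    (fun z hz ↦ by
      have h1 := hlow _ (hAU' (hmaps (mem_closedBall_zero_iff.2 hz.le))) y (hAU' hy)
      have h2 := hFt y (hAU' hy)
      rw [add_sub_cancel_left, e.norm_map, hz] at h1
      have h3 : D⁻¹ * (2 * D * Q * t) = 2 * (Q * t) := by field_simp
      rw [h3] at h1
      simp only [map_zero, add_zero, ← map_sub, LinearIsometryEquiv.norm_map]
      rw [norm_sub_rev]
      linarith [mul_pos hQ ht])
  exact hesc ⟨y + e z, hmaps hz, e.symm.injective hFz⟩
end
end

section
/- There exists C > 0 such that for all t, t' ∈ (0,1], the Lebesgue measure of {x ∈ ℝ² : dist(x, γ₁([0,1])) ≤ t} ∩ {x ∈ ℝ² : dist(x, γ₂([0,1])) ≤ t'} is at most C t t'. -/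
open Set Metric MeasureTheory

noncomputable section

open Topology in
/-- If the difference of two curves vanishes only transversally, it is bounded below by a multiple
of the distance of the second parameter to a finite set. -/
theorem exists_finset_mul_abs_sub_le_dist {E : Type*} [NormedAddCommGroup E] [NormedSpace ℝ E]
    {γ₁ γ₂ : ℝ → E} (h₁ : ContDiffOn ℝ 1 γ₁ (Icc 0 1)) (h₂ : ContDiffOn ℝ 1 γ₂ (Icc 0 1))
    (htrans : ∀ u ∈ Icc (0 : ℝ) 1, ∀ v ∈ Icc (0 : ℝ) 1, γ₁ u = γ₂ v →
      LinearIndependent ℝ ![derivWithin γ₁ (Icc (0 : ℝ) 1) u,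
        derivWithin γ₂ (Icc (0 : ℝ) 1) v]) :
    ∃ S : Finset ℝ, ∃ c > 0, ∀ u ∈ Icc (0 : ℝ) 1, ∀ v ∈ Icc (0 : ℝ) 1,
      ∃ p ∈ S, c * |v - p| ≤ dist (γ₁ u) (γ₂ v) := by
  suffices H : ∃ S : Finset ℝ, ∃ c > 0, ∀ w ∈ Icc (0 : ℝ) 1 ×ˢ Icc (0 : ℝ) 1,
      ∃ p ∈ S, c * |w.2 - p| ≤ dist (γ₁ w.1) (γ₂ w.2) by
    obtain ⟨S, c, hc, H⟩ := H
    exact ⟨S, c, hc, fun u hu v hv => H (u, v) ⟨hu, hv⟩⟩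
  refine (isCompact_Icc.prod isCompact_Icc).induction_on
    (p := fun s => ∃ S : Finset ℝ, ∃ c > 0, ∀ w ∈ s,
      ∃ p ∈ S, c * |w.2 - p| ≤ dist (γ₁ w.1) (γ₂ w.2)) ?_ ?_ ?_ ?_
  · exact ⟨∅, 1, one_pos, by simp⟩
  · rintro s t hst ⟨S, c, hc, H⟩
    exact ⟨S, c, hc, fun w hw => H w (hst hw)⟩
  · rintro s t ⟨S, c, hc, H⟩ ⟨T, d, hd, H'⟩
    refine ⟨S ∪ T, min c d, lt_min hc hd, ?_⟩
    rintro w (hw | hw)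
    · obtain ⟨p, hp, h⟩ := H w hw
      exact ⟨p, Finset.mem_union_left _ hp, le_trans (by gcongr; exact min_le_left _ _) h⟩
    · obtain ⟨p, hp, h⟩ := H' w hw
      exact ⟨p, Finset.mem_union_right _ hp, le_trans (by gcongr; exact min_le_right _ _) h⟩
  · rintro ⟨u, v⟩ ⟨hu, hv⟩
    set K := Icc (0 : ℝ) 1 ×ˢ Icc (0 : ℝ) 1
    suffices H : ∃ c > 0, ∀ᶠ w in 𝓝[K] (u, v), c * |w.2 - v| ≤ dist (γ₁ w.1) (γ₂ w.2) by
      obtain ⟨c, hc, H⟩ := H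
      exact ⟨_, H, {v}, c, hc, fun w hw => ⟨v, by simp, hw⟩⟩
    have hf₁ : HasFDerivWithinAt (fun w : ℝ × ℝ => γ₁ w.1) _ K (u, v) :=
      ((h₁.differentiableOn one_ne_zero u hu).hasFDerivWithinAt).comp (u, v)
        hasFDerivWithinAt_fst fun w hw => hw.1
    have hf₂ : HasFDerivWithinAt (fun w : ℝ × ℝ => γ₂ w.2) _ K (u, v) :=
      ((h₂.differentiableOn one_ne_zero v hv).hasFDerivWithinAt).comp (u, v)
        hasFDerivWithinAt_snd fun w hw => hw.2
    set F : ℝ × ℝ →L[ℝ] E :=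
      (fderivWithin ℝ γ₁ (Icc 0 1) u).comp (ContinuousLinearMap.fst ℝ ℝ ℝ) -
        (fderivWithin ℝ γ₂ (Icc 0 1) v).comp (ContinuousLinearMap.snd ℝ ℝ ℝ) with hFdef
    have hF : HasFDerivWithinAt (fun w : ℝ × ℝ => γ₁ w.1 - γ₂ w.2) F K (u, v) := hf₁.sub hf₂
    by_cases h0 : γ₁ u = γ₂ v
    · obtain ⟨A, hA0, hA⟩ := F.toLinearMap.exists_antilipschitzWith <|
        LinearMap.ker_eq_bot'.2 fun y hy => by
          have h1 (γ : ℝ → E) (x a : ℝ) :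
              fderivWithin ℝ γ (Icc 0 1) x a = a • derivWithin γ (Icc 0 1) x := by
            rw [← fderivWithin_derivWithin, ← map_smul, smul_eq_mul, mul_one]
          have h2 := LinearIndependent.pair_iff.1 (htrans u hu v hv h0) y.1 (-y.2) (by
            simpa [hFdef, h1, sub_eq_add_neg] using hy)
          exact Prod.ext h2.1 (neg_eq_zero.1 h2.2)
      have hA0' : (0 : ℝ) < A := hA0
      refine ⟨(2 * A : ℝ)⁻¹, by positivity, ?_⟩
      filter_upwards [hF.isLittleO.def (show (0 : ℝ) < (2 * A : ℝ)⁻¹ by positivity)] with w hw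
      have h1 : ‖w - (u, v)‖ ≤ A * ‖F (w - (u, v))‖ := by
        simpa using hA.le_mul_dist (w - (u, v)) 0
      have h2 : ‖F (w - (u, v))‖ ≤ dist (γ₁ w.1) (γ₂ w.2) + (2 * A : ℝ)⁻¹ * ‖w - (u, v)‖ := by
        rw [h0, sub_self, sub_zero] at hw
        rw [dist_eq_norm]
        linarith [norm_sub_norm_le (F (w - (u, v))) (γ₁ w.1 - γ₂ w.2),
          norm_sub_rev (F (w - (u, v))) (γ₁ w.1 - γ₂ w.2)]
      have h3 : |w.2 - v| ≤ ‖w - (u, v)‖ := norm_snd_le (w - (u, v))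
      have h4 : A * ((2 * A : ℝ)⁻¹ * ‖w - (u, v)‖) = ‖w - (u, v)‖ / 2 := by field_simp
      rw [inv_mul_le_iff₀ (by positivity)]
      linarith [mul_le_mul_of_nonneg_left h2 hA0'.le]
    · have hpos : 0 < dist (γ₁ u) (γ₂ v) := dist_pos.2 h0
      have hcont : ContinuousWithinAt (fun w : ℝ × ℝ => dist (γ₁ w.1) (γ₂ w.2)) K (u, v) :=
        hf₁.continuousWithinAt.dist hf₂.continuousWithinAt
      refine ⟨dist (γ₁ u) (γ₂ v) / 2, half_pos hpos, ?_⟩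
      filter_upwards [hcont.eventually (lt_mem_nhds (half_lt_self hpos)), self_mem_nhdsWithin]
        with w hw hwK
      have : |w.2 - v| ≤ 1 := by
        rw [abs_le]; constructor <;> linarith [hwK.2.1, hwK.2.2, hv.1, hv.2]
      nlinarith

/-- The `s`-neighbourhood of a piece of parameter length `2 * r` of a Lipschitz curve has area
at most a multiple of `r * s`. -/
theorem volume_neighborhood_lipschitzOnWith_le {γ : ℝ → E2} {I : Set ℝ} {K : NNReal}
    (hγ : LipschitzOnWith K γ I) (p : ℝ) {r s : ℝ} (hs : 0 < s) (hsr : s ≤ r) :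
    volume {x : E2 | ∃ v ∈ I, |v - p| ≤ r ∧ dist x (γ v) ≤ s} ≤
      ENNReal.ofReal (5 * (2 + K) ^ 2 * Real.pi * r * s) := by
  set A : ℤ → Set E2 := fun k => {x | ∃ v ∈ I, ⌊(v - p) / s⌋ = k ∧ dist x (γ v) ≤ s}
  set R : ℝ := (2 + K) * s with hR
  have hA (k : ℤ) : volume (A k) ≤ ENNReal.ofReal (R ^ 2 * Real.pi) := by
    rcases (A k).eq_empty_or_nonempty with h | ⟨x, v, hv, hvk, hxv⟩
    · simp [h]
    calc volume (A k) ≤ volume (closedBall x R) := by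
          refine measure_mono ?_
          rintro y ⟨w, hw, hwk, hyw⟩
          have h1 : |(v - p) / s - (w - p) / s| < 1 :=
            Int.abs_sub_lt_one_of_floor_eq_floor (hvk.trans hwk.symm)
          have h2 : dist w v ≤ s := by
            rw [← sub_div, abs_div, abs_of_pos hs, div_lt_one hs] at h1
            rw [sub_sub_sub_cancel_right] at h1
            rw [dist_comm, Real.dist_eq]
            exact h1.le
          have h3 := hγ.dist_le_mul w hw v hv
          have h4 : (K : ℝ) * dist w v ≤ K * s := by gcongr
          rw [mem_closedBall, hR]
          linarith [dist_triangle4 y (γ w) (γ v) x, dist_comm x (γ v)]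
      _ = ENNReal.ofReal (R ^ 2 * Real.pi) := by
          rw [EuclideanSpace.volume_closedBall_fin_two, ENNReal.ofReal_mul (sq_nonneg R),
            ENNReal.ofReal_pow (by positivity)]
  set m : ℕ := ⌊r / s⌋₊ + 1 with hm
  have hmr : (m : ℝ) ≤ r / s + 1 := by
    rw [hm]; push_cast
    gcongr
    exact Nat.floor_le (div_nonneg (hs.le.trans hsr) hs.le)
  have hrm : r / s ≤ m := by
    rw [hm]; push_cast
    exact (Nat.lt_floor_add_one _).le
  have hrs : 1 ≤ r / s := (one_le_div hs).2 hsr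
  calc volume {x : E2 | ∃ v ∈ I, |v - p| ≤ r ∧ dist x (γ v) ≤ s}
      ≤ volume (⋃ k ∈ Finset.Icc (-m : ℤ) m, A k) := by
        refine measure_mono ?_
        rintro x ⟨v, hv, hvr, hxv⟩
        simp only [mem_iUnion]
        refine ⟨⌊(v - p) / s⌋, ?_, v, hv, rfl, hxv⟩
        have h1 : |(v - p) / s| ≤ m := by
          rw [abs_div, abs_of_pos hs]
          exact le_trans (by gcongr) hrm
        rw [abs_le] at h1
        rw [Finset.mem_Icc]
        refine ⟨Int.le_floor.2 (by push_cast; exact h1.1), ?_⟩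
        exact_mod_cast (Int.floor_le _).trans h1.2
    _ ≤ ∑ k ∈ Finset.Icc (-m : ℤ) m, volume (A k) := measure_biUnion_finset_le _ _
    _ ≤ ∑ k ∈ Finset.Icc (-m : ℤ) m, ENNReal.ofReal (R ^ 2 * Real.pi) :=
        Finset.sum_le_sum fun k _ => hA k
    _ = ENNReal.ofReal ((2 * m + 1) * (R ^ 2 * Real.pi)) := by
        have hcard : (Finset.Icc (-m : ℤ) m).card = 2 * m + 1 := by
          rw [Int.card_Icc]; omega
        rw [Finset.sum_const, hcard, nsmul_eq_mul, ← ENNReal.ofReal_natCast,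
          ← ENNReal.ofReal_mul (Nat.cast_nonneg _)]
        push_cast
        rfl
    _ ≤ ENNReal.ofReal (5 * (2 + K) ^ 2 * Real.pi * r * s) := by
        refine ENNReal.ofReal_le_ofReal ?_
        have h5 : (2 * m + 1 : ℝ) ≤ 5 * (r / s) := by linarith
        calc (2 * m + 1 : ℝ) * (R ^ 2 * Real.pi) ≤ 5 * (r / s) * (R ^ 2 * Real.pi) := by gcongr
          _ = 5 * (2 + K) ^ 2 * Real.pi * r * s := by rw [hR]; field_simp

/-- Case of the area bound in which the neighbourhood of the second curve is the thinner one. -/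
theorem exists_volume_inter_neighborhoods_le {γ₁ γ₂ : ℝ → E2}
    (h₁ : ContDiffOn ℝ 1 γ₁ (Icc 0 1)) (h₂ : ContDiffOn ℝ 1 γ₂ (Icc 0 1))
    (htrans : ∀ u ∈ Icc (0 : ℝ) 1, ∀ v ∈ Icc (0 : ℝ) 1, γ₁ u = γ₂ v →
      LinearIndependent ℝ ![derivWithin γ₁ (Icc (0 : ℝ) 1) u,
        derivWithin γ₂ (Icc (0 : ℝ) 1) v]) :
    ∃ C > 0, ∀ t t' : ℝ, 0 < t' → t' ≤ t →
      volume ({x : E2 | infDist x (γ₁ '' Icc (0 : ℝ) 1) ≤ t} ∩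
          {x : E2 | infDist x (γ₂ '' Icc (0 : ℝ) 1) ≤ t'}) ≤ ENNReal.ofReal (C * t * t') := by
  obtain ⟨K, hK⟩ := h₂.exists_lipschitzOnWith one_ne_zero (convex_Icc 0 1) isCompact_Icc
  obtain ⟨S, c, hc, hS⟩ := exists_finset_mul_abs_sub_le_dist h₁ h₂ htrans
  refine ⟨(S.card + 1) * (5 * (2 + K) ^ 2 * Real.pi * (2 / c + 1)), by positivity, ?_⟩
  intro t t' ht' htt'
  have ht : 0 < t := ht'.trans_le htt'
  have hnear {γ : ℝ → E2} (hγ : ContDiffOn ℝ 1 γ (Icc 0 1)) {x : E2} {s : ℝ}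
      (hx : infDist x (γ '' Icc (0 : ℝ) 1) ≤ s) : ∃ u ∈ Icc (0 : ℝ) 1, dist x (γ u) ≤ s := by
    obtain ⟨_, ⟨u, hu, rfl⟩, h⟩ :=
      (isCompact_Icc.image_of_continuousOn hγ.continuousOn).exists_infDist_eq_dist
        ((nonempty_Icc.2 zero_le_one).image γ) x
    exact ⟨u, hu, h ▸ hx⟩
  set r : ℝ := (2 / c + 1) * t with hr
  have hrt : t' ≤ r := by
    have : 0 ≤ 2 / c * t := by positivity
    linarith
  calc _ ≤ volume (⋃ p ∈ S, {x : E2 | ∃ v ∈ Icc (0 : ℝ) 1, |v - p| ≤ r ∧ dist x (γ₂ v) ≤ t'}) := by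
        refine measure_mono ?_
        rintro x ⟨hx₁, hx₂⟩
        obtain ⟨u, hu, hxu⟩ := hnear h₁ hx₁
        obtain ⟨v, hv, hxv⟩ := hnear h₂ hx₂
        obtain ⟨p, hp, hpv⟩ := hS u hu v hv
        simp only [mem_iUnion]
        refine ⟨p, hp, v, hv, ?_, hxv⟩
        have h2 : |v - p| ≤ 2 * t / c := by
          rw [le_div_iff₀ hc]
          linarith [dist_triangle_left (γ₁ u) (γ₂ v) x]
        calc |v - p| ≤ 2 * t / c := h2
          _ = r - t := by rw [hr]; ring
          _ ≤ r := by linarith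
    _ ≤ ∑ p ∈ S, volume {x : E2 | ∃ v ∈ Icc (0 : ℝ) 1, |v - p| ≤ r ∧ dist x (γ₂ v) ≤ t'} :=
        measure_biUnion_finset_le _ _
    _ ≤ ∑ p ∈ S, ENNReal.ofReal (5 * (2 + K) ^ 2 * Real.pi * r * t') :=
        Finset.sum_le_sum fun p _ => volume_neighborhood_lipschitzOnWith_le hK p ht' hrt
    _ = ENNReal.ofReal (S.card * (5 * (2 + K) ^ 2 * Real.pi * r * t')) := by
        rw [Finset.sum_const, nsmul_eq_mul, ENNReal.ofReal_mul (Nat.cast_nonneg _),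
          ENNReal.ofReal_natCast]
    _ ≤ _ := by
        refine ENNReal.ofReal_le_ofReal ?_
        calc (S.card : ℝ) * (5 * (2 + K) ^ 2 * Real.pi * r * t')
            ≤ (S.card + 1) * (5 * (2 + K) ^ 2 * Real.pi * r * t') := by
              have : 0 ≤ r := ht'.le.trans hrt
              gcongr
              linarith
          _ = _ := by rw [hr]; ring

/-- the intersection of the `t`- and `t'`-neighbourhoods of two transversal
`C¹` curves has Lebesgue measure at most `C t t'`. -/
theorem transversal_neighborhoods_measure
    (γ₁ γ₂ : ℝ → E2)
    (h₁ : ContDiffOn ℝ 1 γ₁ (Set.Icc (0:ℝ) 1))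
    (h₂ : ContDiffOn ℝ 1 γ₂ (Set.Icc (0:ℝ) 1))
    (hd₁ : ∀ u ∈ Set.Icc (0:ℝ) 1, derivWithin γ₁ (Set.Icc (0:ℝ) 1) u ≠ 0)
    (hd₂ : ∀ v ∈ Set.Icc (0:ℝ) 1, derivWithin γ₂ (Set.Icc (0:ℝ) 1) v ≠ 0)
    (hfin : {q : ℝ × ℝ | q.1 ∈ Set.Icc (0:ℝ) 1 ∧ q.2 ∈ Set.Icc (0:ℝ) 1 ∧
      γ₁ q.1 = γ₂ q.2}.Finite)
    (htrans : ∀ u ∈ Set.Icc (0:ℝ) 1, ∀ v ∈ Set.Icc (0:ℝ) 1, γ₁ u = γ₂ v →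
      LinearIndependent ℝ ![derivWithin γ₁ (Set.Icc (0:ℝ) 1) u,
        derivWithin γ₂ (Set.Icc (0:ℝ) 1) v]) :
    ∃ C > 0, ∀ t ∈ Set.Ioc (0:ℝ) 1, ∀ t' ∈ Set.Ioc (0:ℝ) 1,
      volume ({x : E2 | Metric.infDist x (γ₁ '' Set.Icc (0:ℝ) 1) ≤ t} ∩
              {x : E2 | Metric.infDist x (γ₂ '' Set.Icc (0:ℝ) 1) ≤ t'})
        ≤ ENNReal.ofReal (C * t * t') := by
  obtain ⟨C, hC, H⟩ := exists_volume_inter_neighborhoods_le h₁ h₂ htrans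
  obtain ⟨D, hD, H'⟩ := exists_volume_inter_neighborhoods_le h₂ h₁
    fun v hv u hu h => LinearIndependent.pair_symm_iff.1 (htrans u hu v hv h.symm)
  refine ⟨max C D, lt_max_of_lt_left hC, fun t ht t' ht' => ?_⟩
  have ht0 := ht.1
  have ht0' := ht'.1
  rcases le_total t' t with h | h
  · refine (H t t' ht0' h).trans (ENNReal.ofReal_le_ofReal ?_)
    gcongr
    exact le_max_left _ _
  · rw [inter_comm]
    refine (H' t' t ht0 h).trans (ENNReal.ofReal_le_ofReal ?_)
    rw [mul_right_comm]
    gcongr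
    exact le_max_right _ _
end
end
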